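/- Let f, g and h be entire functions given by everywhere absolutely convergent vector valued Dirichlet series, and let p ≥ 0, q ≥ 0, m ≥ 0 be integers. Assume 0 < λ_h^{(m,q)}(f) ≤ ρ_h^{(m,q)}(f) < +∞, 0 < λ_h^{(m,p)}(g) ≤ ρ_h^{(m,p)}(g) < +∞, and that the indicators τ_h^{(m,q)}(f), τ̄_h^{(m,q)}(f), τ_h^{(m,p)}(g), τ̄_h^{(m,p)}(g), Δ̄_h^{(m,p)}(g) are all positive and finite. Then max{ (τ̄_h^{(m,q)}(f)/τ̄_h^{(m,p)}(g))^{1/λ_h^{(m,p)}(g)}, (τ_h^{(m,q)}(f)/τ_h^{(m,p)}(g))^{1/λ_h^{(m,p)}(g)} } ≤ τ̄_g^{(p,q)}(f) ≤ (τ̄_h^{(m,q)}(f)/Δ̄_h^{(m,p)}(g))^{1/ρ_h^{(m,p)}(g)}. -/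

import Mathlib

open Filter Topology

noncomputable section

/-- An entire function given by an everywhere absolutely convergent
vector valued Dirichlet series, with coefficients in a Banach space `E`. -/
structure VVDS (E : Type*) [NormedAddCommGroup E] [NormedSpace ℂ E] [CompleteSpace E] where
  a : ℕ → E
  lam : ℕ → ℝ
  lam_pos : ∀ n, 0 < lam n
  lam_strictMono : StrictMono lam
  lam_tendsto : Tendsto lam atTop atTop
  log_index_bound : ∃ D : ℝ, ∀ᶠ n : ℕ in atTop, Real.log (n : ℝ) / lam n ≤ D
  coeff_decay : Tendsto (fun n => Real.log ‖a n‖ / lam n) atTop atBot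
  abs_conv : ∀ s : ℂ, Summable (fun n => Real.exp (s.re * lam n) * ‖a n‖)

variable {E F G : Type*} [NormedAddCommGroup E] [NormedSpace ℂ E] [CompleteSpace E]
  [NormedAddCommGroup F] [NormedSpace ℂ F] [CompleteSpace F]
  [NormedAddCommGroup G] [NormedSpace ℂ G] [CompleteSpace G]

/-- The entire function defined by the vector valued Dirichlet series. -/
def VVDS.toFun (f : VVDS E) (s : ℂ) : E := ∑' n, Complex.exp (s * (f.lam n : ℂ)) • f.a n

/-- The maximum modulus function `M_f(σ) = sup_t ‖f(σ+it)‖`. -/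
def VVDS.M (f : VVDS E) (σ : ℝ) : ℝ := ⨆ t : ℝ, ‖f.toFun ((σ : ℂ) + (t : ℂ) * Complex.I)‖

/-- The inverse function of the maximum modulus function. -/
def VVDS.Minv (f : VVDS E) (y : ℝ) : ℝ := sInf {σ : ℝ | y ≤ f.M σ}

/-- The (p,q)-th relative Ritt order of `f` with respect to `g`. -/
def relRittOrder (p q : ℕ) (f : VVDS E) (g : VVDS F) : EReal :=
  limsup (fun σ : ℝ =>
    ((Real.log^[p] (g.Minv (f.M σ)) / Real.log^[q] σ : ℝ) : EReal)) atTop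

/-- The (p,q)-th relative Ritt lower order of `f` with respect to `g`. -/
def relRittLowerOrder (p q : ℕ) (f : VVDS E) (g : VVDS F) : EReal :=
  liminf (fun σ : ℝ =>
    ((Real.log^[p] (g.Minv (f.M σ)) / Real.log^[q] σ : ℝ) : EReal)) atTop

/-- The (p,q)-th relative Ritt type of `f` with respect to `g`. -/
def relRittType (p q : ℕ) (f : VVDS E) (g : VVDS F) : EReal :=
  limsup (fun σ : ℝ =>
    ((Real.log^[p-1] (g.Minv (f.M σ)) /
      (Real.log^[q-1] σ) ^ (relRittOrder p q f g).toReal : ℝ) : EReal)) atTop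

/-- The (p,q)-th relative Ritt lower type of `f` with respect to `g`. -/
def relRittLowerType (p q : ℕ) (f : VVDS E) (g : VVDS F) : EReal :=
  liminf (fun σ : ℝ =>
    ((Real.log^[p-1] (g.Minv (f.M σ)) /
      (Real.log^[q-1] σ) ^ (relRittOrder p q f g).toReal : ℝ) : EReal)) atTop

/-- The (p,q)-th relative Ritt weak type of `f` with respect to `g`. -/
def relRittWeakType (p q : ℕ) (f : VVDS E) (g : VVDS F) : EReal :=
  liminf (fun σ : ℝ =>
    ((Real.log^[p-1] (g.Minv (f.M σ)) /
      (Real.log^[q-1] σ) ^ (relRittLowerOrder p q f g).toReal : ℝ) : EReal)) atTop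

/-- The growth indicator `τ̄_g^{(p,q)}(f)`. -/
def relRittUpperWeakType (p q : ℕ) (f : VVDS E) (g : VVDS F) : EReal :=
  limsup (fun σ : ℝ =>
    ((Real.log^[p-1] (g.Minv (f.M σ)) /
      (Real.log^[q-1] σ) ^ (relRittLowerOrder p q f g).toReal : ℝ) : EReal)) atTop

lemma VVDS.norm_term (f : VVDS E) (s : ℂ) (n : ℕ) :
    ‖Complex.exp (s * (f.lam n : ℂ)) • f.a n‖ = Real.exp (s.re * f.lam n) * ‖f.a n‖ := by
  rw [norm_smul, Complex.norm_exp]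
  simp

lemma VVDS.summable_real (f : VVDS E) (σ : ℝ) :
    Summable (fun n => Real.exp (σ * f.lam n) * ‖f.a n‖) := by
  simpa using f.abs_conv (σ : ℂ)

lemma VVDS.summable_term (f : VVDS E) (s : ℂ) :
    Summable (fun n => Complex.exp (s * (f.lam n : ℂ)) • f.a n) := by
  apply Summable.of_norm
  simp only [f.norm_term]
  exact f.abs_conv s

lemma VVDS.norm_le (f : VVDS E) {s : ℂ} {σ : ℝ} (hs : s.re ≤ σ) :
    ‖f.toFun s‖ ≤ ∑' n, Real.exp (σ * f.lam n) * ‖f.a n‖ := by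
  unfold VVDS.toFun
  refine tsum_of_norm_bounded (f.summable_real σ).hasSum ?_
  intro n
  rw [f.norm_term]
  have := (f.lam_pos n).le
  gcongr

lemma VVDS.bdd (f : VVDS E) (σ : ℝ) :
    BddAbove (Set.range fun t : ℝ => ‖f.toFun ((σ : ℂ) + (t : ℂ) * Complex.I)‖) := by
  refine ⟨∑' n, Real.exp (σ * f.lam n) * ‖f.a n‖, ?_⟩
  · rintro _ ⟨t, rfl⟩
    exact f.norm_le (σ := σ) (by simp)

lemma VVDS.norm_le_M (f : VVDS E) (s : ℂ) : ‖f.toFun s‖ ≤ f.M s.re := by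
  have := le_ciSup (f.bdd s.re) s.im
  simpa [VVDS.M, Complex.re_add_im] using this

lemma VVDS.M_le (f : VVDS E) (σ : ℝ) :
    f.M σ ≤ ∑' n, Real.exp (σ * f.lam n) * ‖f.a n‖ :=
  ciSup_le fun t => f.norm_le (by simp)

lemma VVDS.M_nonneg (f : VVDS E) (σ : ℝ) : 0 ≤ f.M σ :=
  (norm_nonneg _).trans (by simpa using f.norm_le_M (σ : ℂ))

lemma VVDS.differentiable (f : VVDS E) : Differentiable ℂ f.toFun := by
  intro s
  have hU : IsOpen {z : ℂ | z.re < s.re + 1} := isOpen_lt Complex.continuous_re continuous_const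
  have : DifferentiableOn ℂ f.toFun {z : ℂ | z.re < s.re + 1} := by
    refine Complex.differentiableOn_tsum_of_summable_norm (f.summable_real (s.re + 1)) ?_ hU ?_
    · intro i
      apply Differentiable.differentiableOn
      fun_prop
    · intro i w hw
      rw [f.norm_term]
      have := (f.lam_pos i).le
      have hw' : w.re ≤ s.re + 1 := le_of_lt hw
      gcongr
  exact (this s (by simp)).differentiableAt (hU.mem_nhds (by simp))

lemma VVDS.three_lines (f : VVDS E) {l u σ : ℝ} (h1 : l < u) (hl : l ≤ σ) (hu : σ ≤ u) :
    f.M σ ≤ f.M l ^ (1 - (σ - l) / (u - l)) * f.M u ^ ((σ - l) / (u - l)) := by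
  refine ciSup_le fun t => ?_
  have := Complex.HadamardThreeLines.norm_le_interp_of_mem_verticalClosedStrip' (f := f.toFun)
    (z := (σ : ℂ) + (t : ℂ) * Complex.I) (a := f.M l) (b := f.M u) h1 ?_
    f.differentiable.diffContOnCl ?_ ?_ ?_
  · simpa using this
  · simp [Complex.HadamardThreeLines.verticalClosedStrip, hl, hu]
  · refine ⟨∑' n, Real.exp (u * f.lam n) * ‖f.a n‖, ?_⟩
    · rintro _ ⟨z, hz, rfl⟩
      exact f.norm_le (σ := u) hz.2
  · rintro z hz
    have := f.norm_le_M z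
    rwa [show z.re = l from hz] at this
  · rintro z hz
    have := f.norm_le_M z
    rwa [show z.re = u from hz] at this

lemma VVDS.M_tendsto_atBot (f : VVDS E) : Tendsto f.M atBot (𝓝 0) := by
  have h0 := f.summable_real 0
  simp only [zero_mul, Real.exp_zero, one_mul] at h0
  have : Tendsto (fun σ : ℝ => Real.exp (σ * f.lam 0) * ∑' n, ‖f.a n‖) atBot (𝓝 0) := by
    have h : Tendsto (fun σ : ℝ => Real.exp (σ * f.lam 0)) atBot (𝓝 0) :=
      Real.tendsto_exp_atBot.comp (tendsto_id.atBot_mul_const (f.lam_pos 0))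
    simpa using h.mul_const (∑' n, ‖f.a n‖)
  refine tendsto_of_tendsto_of_tendsto_of_le_of_le' tendsto_const_nhds this
    (Eventually.of_forall f.M_nonneg) ?_
  filter_upwards [eventually_le_atBot (0:ℝ)] with σ hσ
  refine (f.M_le σ).trans ?_
  rw [← tsum_mul_left]
  refine (f.summable_real σ).tsum_le_tsum (fun n => ?_) (h0.mul_left _)
  gcongr ?_ * _
  apply Real.exp_le_exp.2
  exact mul_le_mul_of_nonpos_left (f.lam_strictMono.monotone (Nat.zero_le n)) hσ

lemma VVDS.exists_ne (f : VVDS E) : ∃ n, f.a n ≠ 0 := by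
  by_contra! hc
  have := (f.coeff_decay.eventually (eventually_lt_atBot (0:ℝ))).exists
  simp [hc] at this

lemma VVDS.exists_M_pos (f : VVDS E) : ∀ᶠ σ in atBot, 0 < f.M σ := by
  classical
  set N := Nat.find f.exists_ne with hN
  have hN1 : f.a N ≠ 0 := Nat.find_spec f.exists_ne
  have hN2 : ∀ n < N, f.a n = 0 := fun n hn => by simpa using Nat.find_min f.exists_ne hn
  have h0 := f.summable_real 0
  simp only [zero_mul, Real.exp_zero, one_mul] at h0
  have key : Tendsto (fun σ : ℝ => ∑' n, Complex.exp ((σ : ℂ) * ((f.lam n : ℂ) - f.lam N)) • f.a n)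
      atBot (𝓝 (∑' n, if n = N then f.a N else 0)) := by
    refine tendsto_tsum_of_dominated_convergence h0 ?_ ?_
    · intro n
      rcases lt_trichotomy n N with h | h | h
      · simp [hN2 n h, h.ne]
      · simp [h]
      · rw [if_neg h.ne', tendsto_zero_iff_norm_tendsto_zero]
        have hp : 0 < f.lam n - f.lam N := sub_pos.2 (f.lam_strictMono h)
        have h : Tendsto (fun σ : ℝ => Real.exp (σ * (f.lam n - f.lam N))) atBot (𝓝 0) :=
          Real.tendsto_exp_atBot.comp (tendsto_id.atBot_mul_const hp)
        simpa [norm_smul, Complex.norm_exp] using h.mul_const (‖f.a n‖)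
    · filter_upwards [eventually_le_atBot (0:ℝ)] with σ hσ n
      by_cases h : n < N
      · simp [hN2 n h]
      · rw [norm_smul, Complex.norm_exp]
        refine mul_le_of_le_one_left (norm_nonneg _) ?_
        rw [Real.exp_le_one_iff]
        simp
        exact mul_nonpos_of_nonpos_of_nonneg hσ
          (sub_nonneg.2 (f.lam_strictMono.monotone (not_lt.1 h)))
  rw [tsum_ite_eq] at key
  filter_upwards [key.eventually_ne hN1] with σ hσ
  refine lt_of_lt_of_le ?_ (f.norm_le_M (σ : ℂ))
  rw [norm_pos_iff]
  intro hz
  apply hσ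
  have : ∀ n, Complex.exp ((σ : ℂ) * ((f.lam n : ℂ) - f.lam N)) • f.a n =
      Complex.exp (-(σ * f.lam N)) • (Complex.exp ((σ : ℂ) * (f.lam n : ℂ)) • f.a n) := by
    intro n
    rw [smul_smul, ← Complex.exp_add]
    congr 2
    ring
  simp_rw [this]
  rw [(f.summable_term σ).tsum_const_smul]
  unfold VVDS.toFun at hz
  rw [hz, smul_zero]

lemma VVDS.M_pos (f : VVDS E) (σ : ℝ) : 0 < f.M σ := by
  refine (f.M_nonneg σ).lt_of_ne' fun h0 => ?_
  obtain ⟨x, hx, hx2⟩ := (f.exists_M_pos.and (eventually_lt_atBot σ)).exists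
  have := f.three_lines (l := x - 1) (u := σ) (σ := x) (by linarith) (by linarith) hx2.le
  rw [h0, Real.zero_rpow, mul_zero] at this
  · linarith
  · apply div_ne_zero <;> linarith

lemma VVDS.logM_convex (f : VVDS E) : ConvexOn ℝ Set.univ (fun σ => Real.log (f.M σ)) := by
  refine LinearOrder.convexOn_of_lt convex_univ ?_
  intro x _ y _ hxy a b ha hb hab
  have h := f.three_lines (l := x) (u := y) (σ := a • x + b • y) hxy
    (by simp only [smul_eq_mul]; obtain rfl : a = 1 - b := by linarith
        nlinarith)
    (by simp only [smul_eq_mul]; obtain rfl : b = 1 - a := by linarith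
        nlinarith)
  have hb' : (a • x + b • y - x) / (y - x) = b := by
    rw [div_eq_iff (by linarith)]
    simp only [smul_eq_mul]
    rw [show a = 1 - b by linarith]; ring
  rw [hb', show 1 - b = a by linarith] at h
  have h2 := Real.log_le_log (f.M_pos _) h
  rw [Real.log_mul (Real.rpow_pos_of_pos (f.M_pos _) _).ne'
    (Real.rpow_pos_of_pos (f.M_pos _) _).ne', Real.log_rpow (f.M_pos _),
    Real.log_rpow (f.M_pos _)] at h2
  exact h2

lemma VVDS.M_continuous (f : VVDS E) : Continuous f.M := by
  have h : Continuous (fun σ => Real.log (f.M σ)) := by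
    rw [← continuousOn_univ]
    exact f.logM_convex.continuousOn isOpen_univ
  have := Real.continuous_exp.comp h
  convert this using 1
  ext σ
  simp [Real.exp_log (f.M_pos σ)]

lemma VVDS.M_strictMono (f : VVDS E) : StrictMono f.M := by
  intro x y hxy
  obtain ⟨z, hz, hz2⟩ := ((f.M_tendsto_atBot.eventually_lt_const (f.M_pos y)).and
    (eventually_lt_atBot x)).exists
  have h := f.logM_convex.slope_mono_adjacent (x := z) (y := x) (z := y) trivial trivial hz2 hxy
  by_contra! hc
  have h1 : Real.log (f.M z) < Real.log (f.M y) := Real.log_lt_log (f.M_pos _) hz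
  have h2 : Real.log (f.M y) ≤ Real.log (f.M x) := Real.log_le_log (f.M_pos _) hc
  have h3 : 0 < (Real.log (f.M x) - Real.log (f.M z)) / (x - z) :=
    div_pos (by linarith) (by linarith)
  have h4 : (Real.log (f.M y) - Real.log (f.M x)) / (y - x) ≤ 0 :=
    div_nonpos_of_nonpos_of_nonneg (by linarith) (by linarith)
  linarith

lemma VVDS.M_tendsto_atTop (f : VVDS E) : Tendsto f.M atTop atTop := by
  have h01 : Real.log (f.M 0) < Real.log (f.M 1) :=
    Real.log_lt_log (f.M_pos _) (f.M_strictMono one_pos)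
  have h : Tendsto (fun σ => Real.log (f.M σ)) atTop atTop := by
    have : Tendsto (fun σ : ℝ => Real.log (f.M 1) +
        (σ - 1) * (Real.log (f.M 1) - Real.log (f.M 0))) atTop atTop := by
      apply tendsto_atTop_add_const_left
      apply Tendsto.atTop_mul_const (by linarith)
      exact tendsto_atTop_add_const_right _ _ tendsto_id
    refine tendsto_atTop_mono' _ ?_ this
    filter_upwards [eventually_gt_atTop (1:ℝ)] with σ hσ
    have h := f.logM_convex.slope_mono_adjacent (x := 0) (y := 1) (z := σ) trivial trivial
      one_pos hσ
    rw [le_div_iff₀ (by linarith)] at h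
    simp at h
    linarith
  have := Real.tendsto_exp_atTop.comp h
  refine this.congr fun σ => ?_
  simp [Real.exp_log (f.M_pos σ)]

lemma VVDS.Minv_M (f : VVDS E) (σ : ℝ) : f.Minv (f.M σ) = σ := by
  unfold VVDS.Minv
  have : {x : ℝ | f.M σ ≤ f.M x} = Set.Ici σ := by
    ext x; simp [f.M_strictMono.le_iff_le]
  rw [this, csInf_Ici]

lemma VVDS.exists_M_eq (f : VVDS E) {y : ℝ} (hy : 0 < y) : ∃ σ, f.M σ = y := by
  obtain ⟨a, ha⟩ := (f.M_tendsto_atBot.eventually_lt_const hy).exists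
  obtain ⟨b, hb⟩ := (f.M_tendsto_atTop.eventually_gt_atTop y).exists
  exact mem_range_of_exists_le_of_exists_ge f.M_continuous ⟨a, ha.le⟩ ⟨b, hb.le⟩

lemma VVDS.M_Minv (f : VVDS E) {y : ℝ} (hy : 0 < y) : f.M (f.Minv y) = y := by
  obtain ⟨σ, rfl⟩ := f.exists_M_eq hy
  rw [f.Minv_M]

lemma VVDS.Minv_M_tendsto (f : VVDS E) (g : VVDS F) :
    Tendsto (fun σ => g.Minv (f.M σ)) atTop atTop := by
  rw [tendsto_atTop]
  intro b
  filter_upwards [f.M_tendsto_atTop.eventually_ge_atTop (g.M b)] with σ hσ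
  rw [← g.M_strictMono.le_iff_le, g.M_Minv (f.M_pos _)]
  exact hσ

lemma VVDS.map_Minv_M (f : VVDS E) (g : VVDS F) :
    map (fun σ => g.Minv (f.M σ)) atTop = atTop := by
  refine le_antisymm (f.Minv_M_tendsto g) ?_
  have : (fun σ => g.Minv (f.M σ)) ∘ (fun σ => f.Minv (g.M σ)) = id := by
    ext x
    simp [f.M_Minv (g.M_pos x), g.Minv_M]
  calc (atTop : Filter ℝ) = map id atTop := map_id.symm
    _ = map (fun σ => g.Minv (f.M σ)) (map (fun σ => f.Minv (g.M σ)) atTop) := by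
      rw [map_map, this]
    _ ≤ _ := map_mono (g.Minv_M_tendsto f)

lemma ev_gt_of_liminf {α : Type*} {l : Filter α} {u : α → ℝ}
    (h : (0 : EReal) < liminf (fun x => (u x : EReal)) l) :
    ∃ c : ℝ, 0 < c ∧ ∀ᶠ x in l, c < u x := by
  obtain ⟨c, h1, h2⟩ := EReal.lt_iff_exists_real_btwn.1 h
  refine ⟨c, by exact_mod_cast h1, ?_⟩
  filter_upwards [eventually_lt_of_lt_liminf h2] with x hx
  exact_mod_cast hx

lemma ev_lt_of_limsup {α : Type*} {l : Filter α} {u : α → ℝ}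
    (h : limsup (fun x => (u x : EReal)) l < ⊤) :
    ∃ c : ℝ, ∀ᶠ x in l, u x < c := by
  obtain ⟨c, h1, h2⟩ := EReal.lt_iff_exists_real_btwn.1 h
  refine ⟨c, ?_⟩
  filter_upwards [eventually_lt_of_limsup_lt h1] with x hx
  exact_mod_cast hx

lemma tendsto_log_div {α : Type*} {l : Filter α} {φ B : α → ℝ} {b c K : ℝ} (hc : 0 < c)
    (hB : Tendsto B l atTop) (h1 : ∀ᶠ x in l, c < φ x / B x ^ b)
    (h2 : ∀ᶠ x in l, φ x / B x ^ b < K) :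
    Tendsto (fun x => Real.log (φ x) / Real.log (B x)) l (𝓝 b) := by
  have hlB : Tendsto (fun x => Real.log (B x)) l atTop := Real.tendsto_log_atTop.comp hB
  have hz : Tendsto (fun x => Real.log (φ x / B x ^ b) / Real.log (B x)) l (𝓝 0) := by
    have e1 : Tendsto (fun x => Real.log c / Real.log (B x)) l (𝓝 0) :=
      tendsto_const_nhds.div_atTop hlB
    have e2 : Tendsto (fun x => Real.log K / Real.log (B x)) l (𝓝 0) :=
      tendsto_const_nhds.div_atTop hlB
    refine tendsto_of_tendsto_of_tendsto_of_le_of_le' e1 e2 ?_ ?_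
    · filter_upwards [h1, hlB.eventually_gt_atTop 0] with x hx hx2
      have := Real.log_le_log hc hx.le
      gcongr
    · filter_upwards [h1, h2, hlB.eventually_gt_atTop 0] with x hx hx3 hx2
      have := Real.log_le_log (hc.trans hx) hx3.le
      gcongr
  have := hz.add_const b
  rw [zero_add] at this
  refine this.congr' ?_
  filter_upwards [h1, hlB.eventually_gt_atTop 0, hB.eventually_gt_atTop 0] with x hx hx2 hx3
  have hp : 0 < B x ^ b := Real.rpow_pos_of_pos hx3 b
  have hφ : 0 < φ x := by
    have := hc.trans hx
    exact (div_pos_iff_of_pos_right hp).1 this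
  rw [Real.log_div hφ.ne' hp.ne', Real.log_rpow hx3]
  field_simp
  ring

lemma tendsto_iter_log (n : ℕ) : Tendsto (fun x : ℝ => Real.log^[n] x) atTop atTop :=
  Real.tendsto_log_atTop.iterate n

lemma index_iff (f : VVDS E) (h : VVDS G) (m q : ℕ)
    (h1 : (0 : EReal) < relRittLowerOrder m q f h)
    (h2 : relRittLowerOrder m q f h ≤ relRittOrder m q f h)
    (h3 : relRittOrder m q f h < ⊤)
    (h4 : (0 : EReal) < relRittWeakType m q f h)
    (h5 : relRittUpperWeakType m q f h < ⊤) : m = 0 ↔ q = 0 := by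
  have ha : 0 < (relRittLowerOrder m q f h).toReal :=
    EReal.toReal_pos h1 (h2.trans_lt h3).ne
  unfold relRittWeakType at h4
  unfold relRittUpperWeakType at h5
  generalize (relRittLowerOrder m q f h).toReal = a at ha h4 h5
  obtain ⟨c, hc, hc'⟩ := ev_gt_of_liminf h4
  obtain ⟨K, hK⟩ := ev_lt_of_limsup h5
  rcases m with _ | m <;> rcases q with _ | q
  · simp
  · exfalso
    obtain ⟨K', hK'⟩ := ev_lt_of_limsup h3
    simp only [Function.iterate_succ_apply', Function.iterate_zero, id, Nat.zero_sub,
      Nat.add_sub_cancel] at *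
    have hB := tendsto_iter_log q
    have hB2 : Tendsto (fun x : ℝ => c * (a / 2 * (Real.log^[q] x) ^ (a / 2))) atTop atTop := by
      apply Tendsto.const_mul_atTop hc
      apply Tendsto.const_mul_atTop (by linarith)
      exact (tendsto_rpow_atTop (by linarith)).comp hB
    obtain ⟨x, hx1, hx2, hx3, hx4⟩ := (hK'.and (hc'.and ((hB.eventually_gt_atTop 1).and
      (hB2.eventually_gt_atTop K')))).exists
    set y := Real.log^[q] x
    have hy0 : 0 < y := by linarith
    have hl : 0 < Real.log y := Real.log_pos hx3
    have hll := Real.log_le_rpow_div hy0.le (show 0 < a / 2 by linarith)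
    rw [div_lt_iff₀ hl] at hx1
    rw [lt_div_iff₀ (Real.rpow_pos_of_pos hy0 a)] at hx2
    have hs : y ^ a = y ^ (a / 2) * y ^ (a / 2) := by
      rw [← Real.rpow_add hy0]; congr 1; ring
    have hp := Real.rpow_pos_of_pos hy0 (a / 2)
    set w := y ^ (a / 2)
    rw [hs] at hx2
    have e1 : a / 2 * Real.log y ≤ w := by
      rw [le_div_iff₀ (by linarith)] at hll; linarith
    have e2 : K' * Real.log y < c * (a / 2 * w) * Real.log y := by gcongr
    have e3 : c * (a / 2 * w) * Real.log y ≤ c * (w * w) := by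
      have : c * w * (a / 2 * Real.log y) ≤ c * w * w := by gcongr
      linarith
    linarith
  · exfalso
    obtain ⟨c', hc1, hc2⟩ := ev_gt_of_liminf h1
    simp only [Function.iterate_succ_apply', Function.iterate_zero, id, Nat.zero_sub,
      Nat.add_sub_cancel] at *
    have ht := tendsto_log_div hc tendsto_id hc' hK
    have hl : Tendsto (fun x : ℝ => Real.log x / x) atTop (𝓝 0) := by
      have := Real.isLittleO_log_id_atTop.tendsto_div_nhds_zero
      simpa using this
    have := ht.mul hl
    rw [mul_zero] at this
    obtain ⟨x, hx1, hx2, hx3⟩ := (hc2.and ((this.eventually_lt_const hc1).and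
      (eventually_gt_atTop 1))).exists
    have hlx := Real.log_pos hx3
    simp only [id] at hx2
    rw [div_mul_div_cancel₀ hlx.ne'] at hx2
    linarith
  · simp

section Ratio

variable {α : Type*} {l : Filter α} [NeBot l] {u v r : α → ℝ} {b U V : ℝ}

lemma eps_tendsto (s t : ℝ) (hb : 0 < b) (hV : 0 < V) :
    Tendsto (fun ε : ℝ => (((((U + s * ε) / (V + t * ε)) ^ (1 / b) : ℝ)) : EReal)) (𝓝[>] 0)
      (𝓝 (((U / V) ^ (1 / b) : ℝ) : EReal)) := by
  apply EReal.tendsto_coe.2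
  have h : ContinuousAt (fun ε : ℝ => ((U + s * ε) / (V + t * ε)) ^ (1 / b)) 0 := by
    refine ContinuousAt.rpow_const ?_ (Or.inr (by positivity))
    refine ContinuousAt.div (by fun_prop) (by fun_prop) (by simpa using hV.ne')
  have h2 := h.tendsto
  simp only [mul_zero, add_zero] at h2
  exact h2.mono_left nhdsWithin_le_nhds

lemma ratio_upper (hb : 0 < b) (hU : 0 < U) (hV : 0 < V)
    (hu0 : ∀ᶠ x in l, 0 < u x)
    (hu : limsup (fun x => (u x : EReal)) l = (U : EReal))
    (hv : liminf (fun x => (v x : EReal)) l = (V : EReal))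
    (hr : ∀ᶠ x in l, r x = (u x / v x) ^ (1 / b)) :
    limsup (fun x => (r x : EReal)) l ≤ (((U / V) ^ (1 / b) : ℝ) : EReal) := by
  refine ge_of_tendsto (eps_tendsto (U := U) 1 (-1) hb hV) ?_
  filter_upwards [self_mem_nhdsWithin, mem_nhdsWithin_of_mem_nhds (Iio_mem_nhds hV)] with ε h1 h2
  have h1 : 0 < ε := h1
  have h2 : ε < V := h2
  have e1 := eventually_lt_of_limsup_lt (f := l) (u := fun x => (u x : EReal))
    (b := ((U + 1 * ε : ℝ) : EReal)) (by rw [hu]; exact_mod_cast (by linarith))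
  have e2 := eventually_lt_of_lt_liminf (f := l) (u := fun x => (v x : EReal))
    (b := ((V + (-1) * ε : ℝ) : EReal)) (by rw [hv]; exact EReal.coe_lt_coe_iff.2 (by linarith))
  refine limsup_le_of_le (by isBoundedDefault) ?_
  filter_upwards [e1, e2, hr, hu0] with x hx1 hx2 hx3 hx4
  rw [hx3]
  have hx1 := EReal.coe_lt_coe_iff.1 hx1
  have hx2 := EReal.coe_lt_coe_iff.1 hx2
  have : 0 < V + (-1) * ε := by linarith
  apply EReal.coe_le_coe_iff.2
  refine Real.rpow_le_rpow (div_nonneg hx4.le (by linarith)) ?_ (by positivity)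
  exact div_le_div₀ (by linarith) hx1.le this hx2.le

lemma ratio_lower_aux (hb : 0 < b) (hU : 0 < U) (hV : 0 < V)
    (hv0 : ∀ᶠ x in l, 0 < v x)
    (h : ∀ ε, 0 < ε → ∃ᶠ x in l, U - ε < u x ∧ v x < V + ε)
    (hr : ∀ᶠ x in l, r x = (u x / v x) ^ (1 / b)) :
    (((U / V) ^ (1 / b) : ℝ) : EReal) ≤ limsup (fun x => (r x : EReal)) l := by
  refine le_of_tendsto (eps_tendsto (U := U) (-1) 1 hb hV) ?_
  filter_upwards [self_mem_nhdsWithin, mem_nhdsWithin_of_mem_nhds (Iio_mem_nhds hU)] with ε h1 h2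
  have h1 : 0 < ε := h1
  have h2 : ε < U := h2
  refine le_limsup_of_frequently_le ?_ (by isBoundedDefault)
  refine ((h ε h1).and_eventually (hr.and hv0)).mono ?_
  rintro x ⟨⟨hx1, hx2⟩, hx3, hx4⟩
  rw [hx3]
  apply EReal.coe_le_coe_iff.2
  refine Real.rpow_le_rpow (div_nonneg (by linarith) (by linarith)) ?_ (by positivity)
  exact div_le_div₀ (by linarith) (by linarith) hx4 (by linarith)

lemma ratio_lower_sup (hb : 0 < b) (hU : 0 < U) (hV : 0 < V)
    (hv0 : ∀ᶠ x in l, 0 < v x)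
    (hu : limsup (fun x => (u x : EReal)) l = (U : EReal))
    (hv : limsup (fun x => (v x : EReal)) l = (V : EReal))
    (hr : ∀ᶠ x in l, r x = (u x / v x) ^ (1 / b)) :
    (((U / V) ^ (1 / b) : ℝ) : EReal) ≤ limsup (fun x => (r x : EReal)) l := by
  refine ratio_lower_aux hb hU hV hv0 (fun ε h1 => ?_) hr
  have e1 := frequently_lt_of_lt_limsup (f := l) (u := fun x => (u x : EReal))
    (b := ((U - ε : ℝ) : EReal)) (by isBoundedDefault)
    (by rw [hu]; exact EReal.coe_lt_coe_iff.2 (by linarith))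
  have e2 := eventually_lt_of_limsup_lt (f := l) (u := fun x => (v x : EReal))
    (b := ((V + ε : ℝ) : EReal)) (by rw [hv]; exact EReal.coe_lt_coe_iff.2 (by linarith))
  refine (e1.and_eventually e2).mono fun x hx => ?_
  exact ⟨EReal.coe_lt_coe_iff.1 hx.1, EReal.coe_lt_coe_iff.1 hx.2⟩

lemma ratio_lower_inf (hb : 0 < b) (hU : 0 < U) (hV : 0 < V)
    (hv0 : ∀ᶠ x in l, 0 < v x)
    (hu : liminf (fun x => (u x : EReal)) l = (U : EReal))
    (hv : liminf (fun x => (v x : EReal)) l = (V : EReal))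
    (hr : ∀ᶠ x in l, r x = (u x / v x) ^ (1 / b)) :
    (((U / V) ^ (1 / b) : ℝ) : EReal) ≤ limsup (fun x => (r x : EReal)) l := by
  refine ratio_lower_aux hb hU hV hv0 (fun ε h1 => ?_) hr
  have e1 := eventually_lt_of_lt_liminf (f := l) (u := fun x => (u x : EReal))
    (b := ((U - ε : ℝ) : EReal))
    (by rw [hu]; exact EReal.coe_lt_coe_iff.2 (by linarith))
  have e2 := frequently_lt_of_liminf_lt (f := l) (u := fun x => (v x : EReal))
    (b := ((V + ε : ℝ) : EReal)) (by isBoundedDefault)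
    (by rw [hv]; exact EReal.coe_lt_coe_iff.2 (by linarith))
  refine (e2.and_eventually e1).mono fun x hx => ?_
  exact ⟨EReal.coe_lt_coe_iff.1 hx.2, EReal.coe_lt_coe_iff.1 hx.1⟩

/-- The lower limit is not changed by a factor tending to one. -/
lemma liminf_div_one (hU : 0 < U)
    (hu : liminf (fun x => (u x : EReal)) l = (U : EReal))
    (hv : Tendsto v l (𝓝 1))
    (hr : ∀ᶠ x in l, r x = u x / v x) :
    liminf (fun x => (r x : EReal)) l = (U : EReal) := by
  apply le_antisymm
  · have h := eps_tendsto (b := 1) (U := U) (V := 1) 1 (-1) one_pos one_pos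
    simp only [div_one, Real.rpow_one] at h
    refine ge_of_tendsto h ?_
    filter_upwards [self_mem_nhdsWithin, mem_nhdsWithin_of_mem_nhds (Iio_mem_nhds one_pos)]
      with ε h1 h2
    have h1 : 0 < ε := h1
    have h2 : ε < 1 := h2
    have e2 := frequently_lt_of_liminf_lt (f := l) (u := fun x => (u x : EReal))
      (b := ((U + 1 * ε : ℝ) : EReal)) (by isBoundedDefault)
      (by rw [hu]; exact EReal.coe_lt_coe_iff.2 (by linarith))
    have e1 := hv.eventually_const_lt (show 1 + (-1) * ε < 1 by linarith)
    refine liminf_le_of_frequently_le ?_ (by isBoundedDefault)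
    refine (e2.and_eventually (e1.and hr)).mono ?_
    rintro x ⟨hx1, hx2, hx3⟩
    rw [hx3]
    have hx1 := EReal.coe_lt_coe_iff.1 hx1
    apply EReal.coe_le_coe_iff.2
    exact div_le_div₀ (by linarith) hx1.le (by linarith) hx2.le
  · have h := eps_tendsto (b := 1) (U := U) (V := 1) (-1) 1 one_pos one_pos
    simp only [div_one, Real.rpow_one] at h
    refine le_of_tendsto h ?_
    filter_upwards [self_mem_nhdsWithin, mem_nhdsWithin_of_mem_nhds (Iio_mem_nhds hU)]
      with ε h1 h2
    have h1 : 0 < ε := h1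
    have h2 : ε < U := h2
    have e2 := eventually_lt_of_lt_liminf (f := l) (u := fun x => (u x : EReal))
      (b := ((U + (-1) * ε : ℝ) : EReal))
      (by rw [hu]; exact EReal.coe_lt_coe_iff.2 (by linarith))
    have e1 := hv.eventually_lt_const (show 1 < 1 + 1 * ε by linarith)
    have e3 := hv.eventually_const_lt (show (0:ℝ) < 1 by linarith)
    refine le_liminf_of_le (by isBoundedDefault) ?_
    filter_upwards [e1, e2, e3, hr] with x hx1 hx2 hx4 hx3
    rw [hx3]
    have hx2 := EReal.coe_lt_coe_iff.1 hx2
    apply EReal.coe_le_coe_iff.2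
    exact div_le_div₀ (by linarith) hx2.le hx4 hx1.le

end Ratio

lemma eq_one_of_zero (f : VVDS E) (h : VVDS G)
    (h1 : (0 : EReal) < relRittLowerOrder 0 0 f h)
    (h2 : relRittLowerOrder 0 0 f h ≤ relRittOrder 0 0 f h)
    (h3 : relRittOrder 0 0 f h < ⊤)
    (h4 : (0 : EReal) < relRittWeakType 0 0 f h)
    (h5 : relRittUpperWeakType 0 0 f h < ⊤) : relRittLowerOrder 0 0 f h = ((1 : ℝ) : EReal) := by
  have hb : ((relRittLowerOrder 0 0 f h).toReal : EReal) = relRittLowerOrder 0 0 f h :=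
    EReal.coe_toReal (h2.trans_lt h3).ne (ne_bot_of_gt h1)
  rw [← hb]
  congr 1
  unfold relRittWeakType at h4
  unfold relRittUpperWeakType at h5
  generalize (relRittLowerOrder 0 0 f h).toReal = a at h4 h5
  obtain ⟨c, hc, hc'⟩ := ev_gt_of_liminf h4
  obtain ⟨K, hK⟩ := ev_lt_of_limsup h5
  obtain ⟨c1, hc1, hc1'⟩ := ev_gt_of_liminf h1
  obtain ⟨K1, hK1⟩ := ev_lt_of_limsup h3
  simp only [Function.iterate_zero, id, Nat.zero_sub] at *
  have t1 := tendsto_log_div hc tendsto_id hc' hK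
  have t2 := tendsto_log_div (φ := fun σ => h.Minv (f.M σ)) (b := 1) (K := K1) hc1 tendsto_id
    (by simpa using hc1') (by simpa using hK1)
  exact tendsto_nhds_unique t1 t2

lemma order_eq_one_of_zero (f : VVDS E) (h : VVDS G)
    (h2 : relRittLowerOrder 0 0 f h ≤ relRittOrder 0 0 f h)
    (h3 : relRittOrder 0 0 f h < ⊤)
    (h4 : (0 : EReal) < relRittLowerType 0 0 f h)
    (h5 : relRittLowerOrder 0 0 f h = ((1 : ℝ) : EReal)) :
    relRittOrder 0 0 f h = ((1 : ℝ) : EReal) := by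
  rw [h5] at h2
  have hb : ((relRittOrder 0 0 f h).toReal : EReal) = relRittOrder 0 0 f h :=
    EReal.coe_toReal h3.ne (ne_bot_of_gt (lt_of_lt_of_le (EReal.bot_lt_coe 1) h2))
  refine le_antisymm ?_ h2
  rw [← hb]
  rw [EReal.coe_le_coe_iff]
  unfold relRittLowerType at h4
  generalize (relRittOrder 0 0 f h).toReal = ρ at h4
  obtain ⟨c, hc, hc'⟩ := ev_gt_of_liminf h4
  obtain ⟨K, hK⟩ := ev_lt_of_limsup h3
  simp only [Function.iterate_zero, id, Nat.zero_sub] at *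
  by_contra! hρ
  have ht : Tendsto (fun x : ℝ => K * x ^ (-(ρ - 1))) atTop (𝓝 0) := by
    simpa using (tendsto_rpow_neg_atTop (show 0 < ρ - 1 by linarith)).const_mul K
  obtain ⟨x, hx1, hx2, hx3, hx4⟩ := (hc'.and (hK.and ((ht.eventually_lt_const hc).and
    (eventually_gt_atTop 0)))).exists
  have hp := Real.rpow_pos_of_pos hx4 (-(ρ - 1))
  have e : h.Minv (f.M x) / x ^ ρ = h.Minv (f.M x) / x * x ^ (-(ρ - 1)) := by
    rw [Real.rpow_neg hx4.le, Real.rpow_sub hx4, Real.rpow_one]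
    have := (Real.rpow_pos_of_pos hx4 ρ).ne'
    field_simp
  rw [e] at hx1
  have : h.Minv (f.M x) / x * x ^ (-(ρ - 1)) < K * x ^ (-(ρ - 1)) := by gcongr
  linarith

lemma comp_eq (f : VVDS E) (g : VVDS F) (h : VVDS G) (σ : ℝ) :
    h.Minv (g.M (g.Minv (f.M σ))) = h.Minv (f.M σ) := by
  rw [g.M_Minv (f.M_pos σ)]

lemma orders (f : VVDS E) (g : VVDS F) (h : VVDS G) (p q m : ℕ)
    (hf1 : (0 : EReal) < relRittLowerOrder m q f h)
    (hf2 : relRittLowerOrder m q f h ≤ relRittOrder m q f h)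
    (hf3 : relRittOrder m q f h < ⊤)
    (hg1 : (0 : EReal) < relRittLowerOrder m p g h)
    (hg2 : relRittLowerOrder m p g h ≤ relRittOrder m p g h)
    (hg3 : relRittOrder m p g h < ⊤)
    (htf1 : (0 : EReal) < relRittWeakType m q f h)
    (htbf2 : relRittUpperWeakType m q f h < ⊤)
    (htg1 : (0 : EReal) < relRittWeakType m p g h)
    (htbg2 : relRittUpperWeakType m p g h < ⊤)
    (hDbg1 : (0 : EReal) < relRittLowerType m p g h) :
    relRittOrder m p g h = relRittLowerOrder m p g h ∧
    relRittLowerOrder p q f g =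
      (((relRittLowerOrder m q f h).toReal / (relRittLowerOrder m p g h).toReal : ℝ) : EReal) := by
  have i1 := index_iff f h m q hf1 hf2 hf3 htf1 htbf2
  have i2 := index_iff g h m p hg1 hg2 hg3 htg1 htbg2
  rcases Nat.eq_zero_or_pos m with rfl | hm
  · obtain rfl := i1.1 rfl
    obtain rfl := i2.1 rfl
    have ea := eq_one_of_zero f h hf1 hf2 hf3 htf1 htbf2
    have eb := eq_one_of_zero g h hg1 hg2 hg3 htg1 htbg2
    have er := order_eq_one_of_zero g h hg2 hg3 hDbg1 eb
    refine ⟨er.trans eb.symm, ?_⟩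
    rw [ea, eb, EReal.toReal_coe, div_one]
    have t : Tendsto (fun x => h.Minv (g.M x) / x) atTop (𝓝 1) := by
      rw [← EReal.tendsto_coe]
      exact tendsto_of_liminf_eq_limsup eb er
    have t2 := t.comp (f.Minv_M_tendsto g)
    refine liminf_div_one one_pos ea t2 ?_
    filter_upwards [(f.Minv_M_tendsto g).eventually_gt_atTop 0, (f.Minv_M_tendsto h).eventually_gt_atTop 0, eventually_gt_atTop 0]
      with x hx1 hx2 hx3
    simp only [Function.comp, comp_eq, Function.iterate_zero, id]
    field_simp
  · obtain ⟨m, rfl⟩ : ∃ k, m = k + 1 := ⟨m - 1, by omega⟩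
    obtain ⟨p, rfl⟩ : ∃ k, p = k + 1 := ⟨p - 1, by omega⟩
    obtain ⟨q, rfl⟩ : ∃ k, q = k + 1 := ⟨q - 1, by omega⟩
    have hb0 : 0 < (relRittLowerOrder (m + 1) (p + 1) g h).toReal :=
      EReal.toReal_pos hg1 (hg2.trans_lt hg3).ne
    obtain ⟨c, hc, hc'⟩ := ev_gt_of_liminf htf1
    obtain ⟨K, hK⟩ := ev_lt_of_limsup htbf2
    obtain ⟨c1, hc1, hc1'⟩ := ev_gt_of_liminf htg1
    obtain ⟨K1, hK1⟩ := ev_lt_of_limsup htbg2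
    have t1 := tendsto_log_div hc (tendsto_iter_log _) hc' hK
    have t2 := tendsto_log_div hc1 (tendsto_iter_log _) hc1' hK1
    have t3 := t2.comp (f.Minv_M_tendsto g)
    simp only [Nat.add_sub_cancel] at t1 t2 t3
    constructor
    · have : relRittOrder (m + 1) (p + 1) g h =
          ((relRittLowerOrder (m + 1) (p + 1) g h).toReal : EReal) := by
        unfold relRittOrder
        simp only [Function.iterate_succ_apply']
        exact (EReal.tendsto_coe.2 t2).limsup_eq
      rw [this]
      exact EReal.coe_toReal (hg2.trans_lt hg3).ne (ne_bot_of_gt hg1)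
    · have t4 := t1.div t3 hb0.ne'
      conv_lhs => unfold relRittLowerOrder
      simp only [Function.iterate_succ_apply']
      refine (EReal.tendsto_coe.2 (t4.congr' ?_)).liminf_eq
      filter_upwards [t3.eventually_ne hb0.ne'] with x hx
      simp only [Function.comp, comp_eq] at hx
      have hx' := left_ne_zero_of_mul hx
      simp only [Function.comp, comp_eq, Pi.div_apply]
      rw [div_div_div_eq, mul_comm (Real.log (Real.log^[q] x)), mul_div_mul_left _ _ hx']

theorem stmt_16 (f : VVDS E) (g : VVDS F) (h : VVDS G) (p q m : ℕ)
    (hf1 : (0 : EReal) < relRittLowerOrder m q f h)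
    (hf2 : relRittLowerOrder m q f h ≤ relRittOrder m q f h)
    (hf3 : relRittOrder m q f h < ⊤)
    (hg1 : (0 : EReal) < relRittLowerOrder m p g h)
    (hg2 : relRittLowerOrder m p g h ≤ relRittOrder m p g h)
    (hg3 : relRittOrder m p g h < ⊤)
    (htf1 : (0 : EReal) < relRittWeakType m q f h)
    (htf2 : relRittWeakType m q f h < ⊤)
    (htbf1 : (0 : EReal) < relRittUpperWeakType m q f h)
    (htbf2 : relRittUpperWeakType m q f h < ⊤)
    (htg1 : (0 : EReal) < relRittWeakType m p g h)
    (htg2 : relRittWeakType m p g h < ⊤)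
    (htbg1 : (0 : EReal) < relRittUpperWeakType m p g h)
    (htbg2 : relRittUpperWeakType m p g h < ⊤)
    (hDbg1 : (0 : EReal) < relRittLowerType m p g h)
    (hDbg2 : relRittLowerType m p g h < ⊤)
    :
    ((max (((relRittUpperWeakType m q f h).toReal / (relRittUpperWeakType m p g h).toReal) ^ (1 / (relRittLowerOrder m p g h).toReal)) (((relRittWeakType m q f h).toReal / (relRittWeakType m p g h).toReal) ^ (1 / (relRittLowerOrder m p g h).toReal)) : ℝ) : EReal) ≤ relRittUpperWeakType p q f g ∧ relRittUpperWeakType p q f g ≤ (((((relRittUpperWeakType m q f h).toReal / (relRittLowerType m p g h).toReal) ^ (1 / (relRittOrder m p g h).toReal)) : ℝ) : EReal) := by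
  obtain ⟨hρ, hlow⟩ := orders f g h p q m hf1 hf2 hf3 hg1 hg2 hg3 htf1 htbf2 htg1 htbg2 hDbg1
  have hD : relRittLowerType m p g h = relRittWeakType m p g h := by
    unfold relRittLowerType relRittWeakType
    rw [hρ]
  rw [hD, hρ]
  have ha : 0 < (relRittLowerOrder m q f h).toReal :=
    EReal.toReal_pos hf1 (hf2.trans_lt hf3).ne
  have hb : 0 < (relRittLowerOrder m p g h).toReal :=
    EReal.toReal_pos hg1 (hg2.trans_lt hg3).ne
  have e1 := EReal.coe_toReal htf2.ne (ne_bot_of_gt htf1)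
  have e2 := EReal.coe_toReal htbf2.ne (ne_bot_of_gt htbf1)
  have e3 := EReal.coe_toReal htg2.ne (ne_bot_of_gt htg1)
  have e4 := EReal.coe_toReal htbg2.ne (ne_bot_of_gt htbg1)
  have p1 := EReal.toReal_pos htf1 htf2.ne
  have p2 := EReal.toReal_pos htbf1 htbf2.ne
  have p3 := EReal.toReal_pos htg1 htg2.ne
  have p4 := EReal.toReal_pos htbg1 htbg2.ne
  obtain ⟨c, hc, hc'⟩ := ev_gt_of_liminf htf1
  obtain ⟨d, hd, hd'⟩ := ev_gt_of_liminf htg1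
  have hd'' := (f.Minv_M_tendsto g).eventually hd'
  have hmap := f.map_Minv_M g
  have hA := (tendsto_iter_log (q - 1)).eventually_gt_atTop 0
  have hB := (f.Minv_M_tendsto g).eventually ((tendsto_iter_log (p - 1)).eventually_gt_atTop 0)
  have e5 : liminf (fun σ : ℝ => ((Real.log^[m-1] (h.Minv (g.M (g.Minv (f.M σ)))) /
      (Real.log^[p-1] (g.Minv (f.M σ))) ^ (relRittLowerOrder m p g h).toReal : ℝ) : EReal)) atTop
      = ((relRittWeakType m p g h).toReal : EReal) := by
    rw [e3]
    have := liminf_comp (fun σ : ℝ => ((Real.log^[m-1] (h.Minv (g.M σ)) /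
      (Real.log^[p-1] σ) ^ (relRittLowerOrder m p g h).toReal : ℝ) : EReal))
      (fun σ => g.Minv (f.M σ)) atTop
    rw [hmap] at this
    exact this
  have e6 : limsup (fun σ : ℝ => ((Real.log^[m-1] (h.Minv (g.M (g.Minv (f.M σ)))) /
      (Real.log^[p-1] (g.Minv (f.M σ))) ^ (relRittLowerOrder m p g h).toReal : ℝ) : EReal)) atTop
      = ((relRittUpperWeakType m p g h).toReal : EReal) := by
    rw [e4]
    have := limsup_comp (fun σ : ℝ => ((Real.log^[m-1] (h.Minv (g.M σ)) /
      (Real.log^[p-1] σ) ^ (relRittLowerOrder m p g h).toReal : ℝ) : EReal))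
      (fun σ => g.Minv (f.M σ)) atTop
    rw [hmap] at this
    exact this
  have hr : ∀ᶠ σ in atTop, Real.log^[p-1] (g.Minv (f.M σ)) /
      (Real.log^[q-1] σ) ^ (relRittLowerOrder p q f g).toReal =
      ((Real.log^[m-1] (h.Minv (f.M σ)) /
        (Real.log^[q-1] σ) ^ (relRittLowerOrder m q f h).toReal) /
      (Real.log^[m-1] (h.Minv (g.M (g.Minv (f.M σ)))) /
      (Real.log^[p-1] (g.Minv (f.M σ))) ^ (relRittLowerOrder m p g h).toReal)) ^
        (1 / (relRittLowerOrder m p g h).toReal) := by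
    rw [hlow, EReal.toReal_coe]
    filter_upwards [hA, hB, hc'] with σ hx1 hx2 hx3
    rw [comp_eq]
    generalize (relRittLowerOrder m p g h).toReal = b at *
    generalize (relRittLowerOrder m q f h).toReal = a at *
    generalize Real.log^[p-1] (g.Minv (f.M σ)) = B at *
    generalize Real.log^[q-1] σ = A at *
    generalize Real.log^[m-1] (h.Minv (f.M σ)) = φ at *
    have hAa := Real.rpow_pos_of_pos hx1 a
    have hBb := Real.rpow_pos_of_pos hx2 b
    have hφ : 0 < φ := (div_pos_iff_of_pos_right hAa).1 (hc.trans hx3)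
    have : φ / A ^ a / (φ / B ^ b) = B ^ b / A ^ a := by field_simp
    rw [this, Real.div_rpow hBb.le hAa.le, ← Real.rpow_mul hx2.le, ← Real.rpow_mul hx1.le,
      mul_one_div_cancel hb.ne', Real.rpow_one, mul_one_div]
  have hu0 := hc'.mono fun x hx => hc.trans hx
  have hv0 := hd''.mono fun x hx => hd.trans hx
  constructor
  · rw [EReal.coe_strictMono.monotone.map_max]
    refine max_le ?_ ?_
    · exact ratio_lower_sup hb p2 p4 hv0 e2.symm e6 hr
    · exact ratio_lower_inf hb p1 p3 hv0 e1.symm e5 hr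
  · exact ratio_upper hb p2 p3 hu0 e2.symm e5 hr
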